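/- arXiv:1904.04860 — 2 statements merged into one kernel-verified Lean document; each statement's English description precedes it below -/
import Mathlib

section
/- For all real numbers τ ≥ 1 and ε > 0, τ^{1+ε} - (1+ε)·τ + ε ≥ (ε/2)·(1 - 1/τ)². -/
/-- The second-order Taylor lower bound for `-log (1 - u)` on `[0, 1)`. -/
theorem add_sq_div_two_le_neg_log_one_sub {u : ℝ} (h0 : 0 ≤ u) (h1 : u < 1) :
    u + u ^ 2 / 2 ≤ -Real.log (1 - u) := by
  have h := Real.hasSum_pow_div_log_of_abs_lt_one (x := u) (by rwa [abs_of_nonneg h0])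
  have h2 := sum_le_hasSum (Finset.range 2) (fun i _ => by positivity) h
  norm_num [Finset.sum_range_succ] at h2
  linarith

theorem stmt2 (τ ε : ℝ) (hτ : 1 ≤ τ) (hε : 0 < ε) :
    τ ^ (1 + ε) - (1 + ε) * τ + ε ≥ ε / 2 * (1 - 1 / τ) ^ 2 := by
  have hpos : 0 < τ := by linarith
  have hinv : 1 / τ ≤ 1 := (div_le_one hpos).2 hτ
  have hinv0 : 0 < 1 / τ := by positivity
  have hmul : τ * (1 / τ) = 1 := by field_simp
  have hlog := add_sq_div_two_le_neg_log_one_sub (u := 1 - 1 / τ) (by linarith) (by linarith)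
  rw [sub_sub_cancel, one_div, Real.log_inv, neg_neg, ← one_div] at hlog
  have hpow : 1 + ε * Real.log τ ≤ τ ^ ε := by
    rw [Real.rpow_def_of_pos hpos]
    linarith [Real.add_one_le_exp (Real.log τ * ε)]
  rw [Real.rpow_add hpos, Real.rpow_one]
  have key : (1 - 1 / τ) ^ 2 / 2 ≤ τ * Real.log τ - τ + 1 := by
    have h1 := mul_le_mul_of_nonneg_left hlog hpos.le
    have h2 := mul_le_mul_of_nonneg_right hτ (sq_nonneg (1 - 1 / τ))
    linarith
  have h3 := mul_le_mul_of_nonneg_left hpow hpos.le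
  have h4 := mul_le_mul_of_nonneg_left key hε.le
  linarith
end

section
/- Let k ≥ 1 and let c_1, d_1, …, c_k, d_k be reals with 0 = c_1 < d_1 < c_2 < d_2 < ⋯ < c_k < d_k = 1, and define U_0, U_1 on {1,…,k} as the interval potentials and meas(E) = ∑_{i=1}^k (d_i - c_i). Then there exists q : {1,…,k} → ℝ with q_i ≥ 0 for all i and ∑_{i=1}^k q_i = 1, such that ∑_{i=1}^k q_i·U_0(i) ≥ 1/(2 - meas(E)) and ∑_{i=1}^k q_i·U_1(i) ≥ 1/(2 - meas(E)). -/
/-- Potential `U_0(i) = ∏_{j=1}^{i-1} (1 - c_{j+1})/(1 - d_j)` (empty product is 1). -/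
noncomputable def U0 (c d : ℕ → ℝ) (i : ℕ) : ℝ :=
  ∏ j ∈ Finset.Icc 1 (i - 1), (1 - c (j + 1)) / (1 - d j)

/-- Potential `U_1(i) = ∏_{j=i}^{k-1} d_j/c_{j+1}` (empty product is 1). -/
noncomputable def U1 (c d : ℕ → ℝ) (k i : ℕ) : ℝ :=
  ∏ j ∈ Finset.Icc i (k - 1), d j / c (j + 1)

theorem U0_succ (c d : ℕ → ℝ) {m : ℕ} (hm : 1 ≤ m) (h : d m ≠ 1) :
    U0 c d (m + 1) * (1 - d m) = U0 c d m * (1 - c (m + 1)) := by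
  obtain ⟨n, rfl⟩ := Nat.exists_eq_add_of_le' hm
  have h' : 1 - d (n + 1) ≠ 0 := sub_ne_zero.mpr h.symm
  simp only [U0, Nat.add_sub_cancel]
  rw [Finset.prod_Icc_succ_top (by omega)]
  field_simp

theorem U1_succ (c d : ℕ → ℝ) {k m : ℕ} (hm : m + 1 ≤ k) (h : c (m + 1) ≠ 0) :
    U1 c d k m * c (m + 1) = U1 c d k (m + 1) * d m := by
  simp only [U1]
  rw [← Finset.mul_prod_Ioc_eq_prod_Icc (show m ≤ k - 1 by omega),
    ← Order.succ_eq_add_one m, Finset.Icc_succ_left_eq_Ioc, Order.succ_eq_add_one]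
  field_simp

/-- The intervals, each enlarged by its two adjacent gaps, have total length
`2 - meas E` once `d 0 = c 1 = 0` and `d k = c (k + 1) = 1`. -/
theorem sum_enlarged_length (c d : ℕ → ℝ) {m : ℕ} (hm : 1 ≤ m) :
    ∑ i ∈ Finset.Icc 1 m, (c (i + 1) - d (i - 1)) =
      c (m + 1) + d m - c 1 - d 0 - ∑ i ∈ Finset.Icc 1 m, (d i - c i) := by
  induction m, hm using Nat.le_induction with
  | base => simp; ring
  | succ m hm ih =>
    rw [Finset.sum_Icc_succ_top (by omega), Finset.sum_Icc_succ_top (by omega), ih]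
    simp only [Nat.add_sub_cancel]
    ring

theorem sum_enlarged_length_mul_U0 (c d : ℕ → ℝ) (hd0 : d 0 = 0) {m : ℕ} (hm : 1 ≤ m)
    (hd : ∀ i, 1 ≤ i → i < m → d i ≠ 1) :
    ∑ i ∈ Finset.Icc 1 m, (c (i + 1) - d (i - 1)) * U0 c d i =
      1 - U0 c d m * (1 - c (m + 1)) := by
  induction m, hm using Nat.le_induction with
  | base => simp [U0, hd0]
  | succ m hm ih =>
    rw [Finset.sum_Icc_succ_top (by omega), ih fun i h1 h2 => hd i h1 (by omega)]
    have := U0_succ c d hm (hd m hm (by omega))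
    simp only [Nat.add_sub_cancel]
    linear_combination this

theorem sum_enlarged_length_mul_U1 (c d : ℕ → ℝ) (hd0 : d 0 = 0) {k m : ℕ} (hm : 1 ≤ m)
    (hmk : m ≤ k) (hc : ∀ i, 1 ≤ i → i < k → c (i + 1) ≠ 0) :
    ∑ i ∈ Finset.Icc 1 m, (c (i + 1) - d (i - 1)) * U1 c d k i =
      U1 c d k m * c (m + 1) := by
  induction m, hm using Nat.le_induction with
  | base => simp [hd0, mul_comm]
  | succ m hm ih =>
    rw [Finset.sum_Icc_succ_top (by omega), ih (by omega)]
    have := U1_succ c d hmk (hc m hm (by omega))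
    simp only [Nat.add_sub_cancel]
    linear_combination this

theorem U0_congr {c d c' d' : ℕ → ℝ} {i : ℕ}
    (hc : ∀ j, 1 ≤ j → j < i → c (j + 1) = c' (j + 1))
    (hd : ∀ j, 1 ≤ j → j < i → d j = d' j) : U0 c d i = U0 c' d' i := by
  refine Finset.prod_congr rfl fun j hj => ?_
  rw [Finset.mem_Icc] at hj
  rw [hc j hj.1 (by omega), hd j hj.1 (by omega)]

theorem U1_congr {c d c' d' : ℕ → ℝ} {k i : ℕ} (hi : 1 ≤ i)
    (hc : ∀ j, 1 ≤ j → j < k → c (j + 1) = c' (j + 1))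
    (hd : ∀ j, 1 ≤ j → j < k → d j = d' j) : U1 c d k i = U1 c' d' k i := by
  refine Finset.prod_congr rfl fun j hj => ?_
  rw [Finset.mem_Icc] at hj
  rw [hc j (by omega) (by omega), hd j (by omega) (by omega)]

/-- Choosing each index with probability proportional to its enlarged interval length gives
both potentials expectation exactly `1 / (2 - meas E)`. -/
theorem exists_distribution_of_boundary (k : ℕ) (c d : ℕ → ℝ) (hk : 1 ≤ k)
    (hd0 : d 0 = 0) (hc1 : c 1 = 0) (hdk : d k = 1) (hck : c (k + 1) = 1)
    (hcd : ∀ i, 1 ≤ i → i ≤ k → c i < d i)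
    (hdc : ∀ i, 1 ≤ i → i < k → d i < c (i + 1)) :
    ∃ q : ℕ → ℝ,
      (∀ i ∈ Finset.Icc 1 k, 0 ≤ q i) ∧
      (∑ i ∈ Finset.Icc 1 k, q i = 1) ∧
      (∑ i ∈ Finset.Icc 1 k, q i * U0 c d i
        = 1 / (2 - ∑ i ∈ Finset.Icc 1 k, (d i - c i))) ∧
      (∑ i ∈ Finset.Icc 1 k, q i * U1 c d k i
        = 1 / (2 - ∑ i ∈ Finset.Icc 1 k, (d i - c i))) := by
  have hpos : ∀ i ∈ Finset.Icc 1 k, 0 < c (i + 1) - d (i - 1) := by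
    intro i hi
    obtain ⟨h1, h2⟩ := Finset.mem_Icc.mp hi
    have hl : d (i - 1) ≤ c i := by
      obtain rfl | h := h1.eq_or_lt
      · simp [hd0, hc1]
      · have := hdc (i - 1) (by omega) (by omega)
        rw [Nat.sub_add_cancel h1] at this
        exact this.le
    have hr : d i ≤ c (i + 1) := by
      obtain rfl | h := h2.eq_or_lt
      · rw [hdk, hck]
      · exact (hdc i h1 h).le
    linarith [hcd i h1 h2]
  have hc_nonneg : ∀ i, 1 ≤ i → i ≤ k → 0 ≤ c i := by
    intro i hi
    induction i, hi using Nat.le_induction with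
    | base => simp [hc1]
    | succ i hi ih =>
      intro h
      linarith [ih (by omega), hcd i hi (by omega), hdc i hi (by omega)]
  have hc_ne : ∀ i, 1 ≤ i → i < k → c (i + 1) ≠ 0 := fun i h1 h2 => by
    linarith [hc_nonneg i h1 h2.le, hcd i h1 h2.le, hdc i h1 h2]
  have hd_le : ∀ i, i ≤ k → 1 ≤ i → d i ≤ 1 := by
    intro i hi
    induction hi using Nat.decreasingInduction with
    | self => simp [hdk]
    | of_succ i hi ih =>
      intro h
      linarith [ih (by omega), hcd (i + 1) (by omega) hi, hdc i h hi]
  have hd_ne : ∀ i, 1 ≤ i → i < k → d i ≠ 1 := fun i h1 h2 => by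
    have := hd_le (i + 1) h2 (by omega)
    exact (show d i < 1 by linarith [hcd (i + 1) (by omega) h2, hdc i h1 h2]).ne
  have hsum : ∑ i ∈ Finset.Icc 1 k, (c (i + 1) - d (i - 1)) =
      2 - ∑ i ∈ Finset.Icc 1 k, (d i - c i) := by
    rw [sum_enlarged_length c d hk, hd0, hc1, hdk, hck]
    ring
  have htotal := Finset.sum_pos hpos ⟨1, by simp [hk]⟩
  refine ⟨fun i => (c (i + 1) - d (i - 1)) / ∑ i ∈ Finset.Icc 1 k, (c (i + 1) - d (i - 1)),
    fun i hi => div_nonneg (hpos i hi).le htotal.le, ?_, ?_, ?_⟩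
  · rw [← Finset.sum_div, div_self htotal.ne']
  · simp_rw [div_mul_eq_mul_div]
    rw [← Finset.sum_div, sum_enlarged_length_mul_U0 c d hd0 hk hd_ne, hck, hsum]
    simp
  · simp_rw [div_mul_eq_mul_div]
    rw [← Finset.sum_div, sum_enlarged_length_mul_U1 c d hd0 hk le_rfl hc_ne, hck, hsum]
    simp [U1, Finset.Icc_eq_empty (show ¬ k ≤ k - 1 by omega)]

theorem stmt14 (k : ℕ) (c d : ℕ → ℝ) (hk : 1 ≤ k)
    (hc1 : c 1 = 0) (hdk : d k = 1)
    (hcd : ∀ i ∈ Finset.Icc 1 k, c i < d i)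
    (hdc : ∀ i ∈ Finset.Icc 1 (k - 1), d i < c (i + 1)) :
    ∃ q : ℕ → ℝ,
      (∀ i ∈ Finset.Icc 1 k, 0 ≤ q i) ∧
      (∑ i ∈ Finset.Icc 1 k, q i = 1) ∧
      (∑ i ∈ Finset.Icc 1 k, q i * U0 c d i
        ≥ 1 / (2 - ∑ i ∈ Finset.Icc 1 k, (d i - c i))) ∧
      (∑ i ∈ Finset.Icc 1 k, q i * U1 c d k i
        ≥ 1 / (2 - ∑ i ∈ Finset.Icc 1 k, (d i - c i))) := by
  set c' := Function.update c (k + 1) 1 with hc'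
  set d' := Function.update d 0 0 with hd'
  have ec : ∀ i, i ≤ k → c' i = c i := fun i hi => Function.update_of_ne (by omega) _ _
  have ed : ∀ i, 1 ≤ i → d' i = d i := fun i hi => Function.update_of_ne (by omega) _ _
  obtain ⟨q, hq0, hq1, hU0, hU1⟩ := exists_distribution_of_boundary k c' d' hk
    (by simp [hd']) (by rw [ec 1 hk, hc1]) (by rw [ed k hk, hdk]) (by simp [hc'])
    (fun i h1 h2 => by
      rw [ec i h2, ed i h1]
      exact hcd i (Finset.mem_Icc.mpr ⟨h1, h2⟩))
    (fun i h1 h2 => by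
      rw [ec (i + 1) h2, ed i h1]
      exact hdc i (Finset.mem_Icc.mpr ⟨h1, by omega⟩))
  have hmeas : ∑ i ∈ Finset.Icc 1 k, (d' i - c' i) = ∑ i ∈ Finset.Icc 1 k, (d i - c i) :=
    Finset.sum_congr rfl fun i hi => by
      rw [Finset.mem_Icc] at hi
      rw [ec i hi.2, ed i hi.1]
  rw [hmeas] at hU0 hU1
  refine ⟨q, hq0, hq1, ?_, ?_⟩
  · rw [← hU0]
    refine (Finset.sum_congr rfl fun i hi => ?_).ge
    rw [Finset.mem_Icc] at hi
    rw [U0_congr (fun j _ h => (ec (j + 1) (by omega)).symm) fun j h _ => (ed j h).symm]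
  · rw [← hU1]
    refine (Finset.sum_congr rfl fun i hi => ?_).ge
    rw [Finset.mem_Icc] at hi
    rw [U1_congr hi.1 (fun j _ h => (ec (j + 1) h).symm) fun j h _ => (ed j h).symm]
end
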